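/- arXiv:1004.5382 — 3 statements merged into one kernel-verified Lean document; each statement's English description precedes it below -/
import Mathlib

section
/- Let S be a state space with abstraction R, and let the transition relation be given by finitely many guarded-update rules (gᵢ, uᵢ), i ∈ I, so that Trans(s₁) = {s₂ | ∃ i, s₁ ∈ gᵢ ∧ (s₁,s₂) ∈ uᵢ}. Define the approximate abstract may one-step predecessor of X ⊆ R by mayPre¹(X) = {r₁ ∈ R | ∃ i ∈ I, ∃ r₂ ∈ X, uᵢ''(r₁ ∩ gᵢ) ∩ r₂ ≠ ∅}. Then the abstract may multi-step predecessor over-approximates concrete reachability: Pre*(⟨X⟩) ⊆ ⟨μW.(X ∪ mayPre¹(W))⟩, where the least fixpoint is taken in the complete lattice of subsets of R. -/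
open Set

/-- One-step predecessor operator: states with a successor in `Y`. -/
def pre1 {S : Type*} (Trans : S → Set S) (Y : Set S) : Set S :=
  {x | (Trans x ∩ Y).Nonempty}

theorem pre1_mono {S : Type*} (Trans : S → Set S) : Monotone (pre1 Trans) :=
  fun _ _ h _ hx => hx.mono (inter_subset_inter_right _ h)

/-- Multi-step predecessor operator: least fixpoint of `X ↦ Y ∪ Pre¹(X)`. -/
def preStar {S : Type*} (Trans : S → Set S) (Y : Set S) : Set S :=
  OrderHom.lfp ⟨fun X => Y ∪ pre1 Trans X,
    fun _ _ h => union_subset_union_right _ (pre1_mono Trans h)⟩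

/-- Image of a set under an update relation. -/
def updImage {S : Type*} (u : Set (S × S)) (A : Set S) : Set S :=
  {s₂ | ∃ s₁ ∈ A, (s₁, s₂) ∈ u}

/-- Approximate abstract may one-step predecessor computed rule-wise. -/
def mayPre1 {S : Type*} (R : Set (Set S)) {I : Type*}
    (g : I → Set S) (u : I → Set (S × S)) (X : Set (Set S)) : Set (Set S) :=
  {r₁ ∈ R | ∃ i : I, ∃ r₂ ∈ X, (updImage (u i) (r₁ ∩ g i) ∩ r₂).Nonempty}

theorem mayPre1_mono {S : Type*} (R : Set (Set S)) {I : Type*}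
    (g : I → Set S) (u : I → Set (S × S)) : Monotone (mayPre1 R g u) := by
  rintro X X' h r ⟨hr, i, r₂, hr₂, hne⟩
  exact ⟨hr, i, r₂, h hr₂, hne⟩

/-- the abstract may multi-step predecessor (computed from the
guarded-update rules) over-approximates concrete reachability:
`Pre*(⟨X⟩) ⊆ ⟨μW.(X ∪ mayPre¹(W))⟩`. -/
theorem preStar_subset_conc_lfp_mayPre1 {S : Type*} (R : Set (Set S))
    (hne : ∀ r ∈ R, r.Nonempty) (hcov : ⋃₀ R = univ)
    {I : Type*} [Fintype I] (g : I → Set S) (u : I → Set (S × S))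
    (Trans : S → Set S)
    (hTrans : ∀ s₁, Trans s₁ = {s₂ | ∃ i : I, s₁ ∈ g i ∧ (s₁, s₂) ∈ u i})
    (X : Set (Set S)) (hX : X ⊆ R) :
    preStar Trans (⋃₀ X) ⊆
      ⋃₀ (OrderHom.lfp ⟨fun W => X ∪ mayPre1 R g u W,
        fun _ _ h => union_subset_union_right _ (mayPre1_mono R g u h)⟩) := by
  set f : Set (Set S) →o Set (Set S) := ⟨fun W => X ∪ mayPre1 R g u W,
    fun _ _ h => union_subset_union_right _ (mayPre1_mono R g u h)⟩
  have hf : X ∪ mayPre1 R g u f.lfp = f.lfp := f.map_lfp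
  refine OrderHom.lfp_le _ (union_subset ?_ ?_)
  · exact sUnion_mono (subset_union_left.trans hf.subset)
  · rintro s ⟨t, hst, r₂, hr₂, htr₂⟩
    rw [hTrans] at hst
    obtain ⟨i, hsg, hsu⟩ := hst
    obtain ⟨r₁, hr₁, hsr₁⟩ : s ∈ ⋃₀ R := hcov ▸ mem_univ s
    exact ⟨r₁, hf.subset (Or.inr ⟨hr₁, i, r₂, hr₂, t, ⟨s, ⟨hsr₁, hsg⟩, hsu⟩, htr₂⟩), hsr₁⟩
end

section
/- Let S be a state space with abstraction R and transition relation Trans. Define the abstract must one-step predecessor of W ⊆ R by mustPre¹(W) = α̲(Pre¹(⟨W⟩)) = {r ∈ R | r ⊆ Pre¹(⟨W⟩)}. Then the abstract must multi-step iteration under-approximates concrete reachability: for every X ⊆ R, ⟨μW.(X ∪ mustPre¹(W))⟩ ⊆ Pre*(⟨X⟩), where the least fixpoint is taken in the complete lattice of subsets of R. -/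
open Set

/-- Abstract must one-step predecessor: `mustPre¹(W) = α̲(Pre¹(⟨W⟩))`. -/
def mustPre1 {S : Type*} (Trans : S → Set S) (R : Set (Set S))
    (W : Set (Set S)) : Set (Set S) :=
  {r ∈ R | r ⊆ pre1 Trans (⋃₀ W)}

theorem mustPre1_mono {S : Type*} (Trans : S → Set S) (R : Set (Set S)) :
    Monotone (mustPre1 Trans R) := fun _ _ h r hr =>
  ⟨hr.1, hr.2.trans (pre1_mono Trans (sUnion_mono h))⟩

/-- the abstract must multi-step iteration under-approximates
concrete reachability: `⟨μW.(X ∪ mustPre¹(W))⟩ ⊆ Pre*(⟨X⟩)`. -/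
theorem conc_lfp_mustPre1_subset_preStar {S : Type*} (Trans : S → Set S)
    (R : Set (Set S)) (hne : ∀ r ∈ R, r.Nonempty) (hcov : ⋃₀ R = univ)
    (X : Set (Set S)) (hX : X ⊆ R) :
    ⋃₀ (OrderHom.lfp ⟨fun W => X ∪ mustPre1 Trans R W,
        fun _ _ h => union_subset_union_right _ (mustPre1_mono Trans R h)⟩) ⊆
      preStar Trans (⋃₀ X) := by
  have preStar_eq : ⋃₀ X ∪ pre1 Trans (preStar Trans (⋃₀ X)) = preStar Trans (⋃₀ X) :=
    OrderHom.map_lfp ⟨fun Z => ⋃₀ X ∪ pre1 Trans Z,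
      fun _ _ h => union_subset_union_right _ (pre1_mono Trans h)⟩
  rw [sUnion_subset_iff]
  refine OrderHom.lfp_le (a := {r | r ⊆ preStar Trans (⋃₀ X)}) _ ?_
  rintro r (hr | ⟨-, hr⟩)
  · exact (subset_sUnion_of_mem hr).trans (subset_union_left.trans preStar_eq.subset)
  · exact (hr.trans (pre1_mono Trans (sUnion_subset fun _ h => h))).trans
      (subset_union_right.trans preStar_eq.subset)
end

section
/- Let V be a finite set of variables, let D be a type of values, and let states be functions s : V → D. For a set X of states, define support(X) = {v ∈ V | there exist states s, s' with s =ᵥ s' and exactly one of s, s' in X}, where s =ᵥ s' means s and s' agree on every variable except possibly v. Then membership in X depends only on the support: if two states s and s' agree on every variable in support(X), then s ∈ X if and only if s' ∈ X. -/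
open Set

/-- `s =ᵥ s'`: the states `s` and `s'` agree on every variable except
possibly `v`. -/
def eqExcept {V D : Type*} (v : V) (s s' : V → D) : Prop :=
  ∀ w, w ≠ v → s w = s' w

/-- The support of a set of states: the variables whose value change can
change membership in `X`. -/
def support {V D : Type*} (X : Set (V → D)) : Set V :=
  {v | ∃ s s', eqExcept v s s' ∧ ¬(s ∈ X ↔ s' ∈ X)}

/-- Changing the value of a single variable outside the support preserves membership. -/
theorem mem_iff_mem_of_eqExcept {V D : Type*} {X : Set (V → D)} {v : V} {s s' : V → D}
    (hv : v ∉ support X) (h : eqExcept v s s') : s ∈ X ↔ s' ∈ X := by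
  by_contra hne
  exact hv ⟨s, s', h, hne⟩

open scoped Classical in
/-- Overwriting finitely many variables of `s` by the values of a state that agrees with `s` on
the support preserves membership. -/
theorem mem_iff_piecewise_mem {V D : Type*} {X : Set (V → D)} {s s' : V → D}
    (h : ∀ v ∈ support X, s v = s' v) (T : Finset V) :
    s ∈ X ↔ T.piecewise s' s ∈ X := by
  induction T using Finset.induction_on with
  | empty => simp
  | insert v T hvT ih =>
    rw [ih, Finset.piecewise_insert]
    by_cases hv : v ∈ support X
    · rw [← h v hv, ← Finset.piecewise_eq_of_notMem T s' s hvT, Function.update_eq_self]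
    · exact mem_iff_mem_of_eqExcept hv fun w hw => (Function.update_of_ne hw _ _).symm

/-- membership in `X` depends only on the support of `X`:
states agreeing on every support variable are either both in `X` or both
out of `X`. -/
theorem support_determines_membership {V : Type*} [Fintype V] {D : Type*}
    (X : Set (V → D)) (s s' : V → D)
    (h : ∀ v ∈ support X, s v = s' v) :
    s ∈ X ↔ s' ∈ X := by
  classical
  simpa using mem_iff_piecewise_mem h Finset.univ
end
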